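/- Let ψ ∈ N(σ), i ∈ {1, …, |N(σ)|} with Pr[ψ ↝ i] > 0, and e ∈ E \ dom(ψ). Conditioned additionally on the event A(e) that e is selected by π* but not by σ: α·E[μ(e) | A(e) ∧ ψ ↝ i] ≥ υ_ψ·E[δ⁺_ψ(e) | A(e) ∧ ψ ↝ i]. -/

import Mathlib

/-!
Common framework for the Stochastic Submodular Cover problem
(Hellerstein–Kletenik–Parthasarathy, "A Tight Bound for Stochastic Submodular Cover").
-/

namespace SSC

open Finset
open scoped Classical

noncomputable section

variable {E O : Type*}

/-- A subrealization assigns to each item either a state or `none` (unassigned).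
A realization corresponds to the case where every item is assigned. -/
abbrev Sub (E O : Type*) := E → Option O

/-- `subext ψ ψ'` means `ψ ⊆ ψ'` as partial assignments of states to items. -/
def subext (ψ ψ' : Sub E O) : Prop := ∀ e o, ψ e = some o → ψ' e = some o

/-- `ssubext ψ ψ'` means `ψ ⊂ ψ'` (strict extension). -/
def ssubext (ψ ψ' : Sub E O) : Prop := subext ψ ψ' ∧ ψ ≠ ψ'

/-- Extend a subrealization `ψ` by assigning state `o` to item `e`. -/
def updateSub [DecidableEq E] (ψ : Sub E O) (e : E) (o : O) : Sub E O :=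
  fun e' => if e' = e then some o else ψ e'

/-- View a (full) realization as a subrealization. -/
def toSub (φ : E → O) : Sub E O := fun e => some (φ e)

variable [Fintype E] [DecidableEq E] [Fintype O] [DecidableEq O]

/-- An instance of the Stochastic Submodular Cover problem: positive item costs `c`,
a probability mass function `p` on realizations with mutually independent item states,
and a utility function `f` on subrealizations which is zero on the empty subrealization,
nonnegative, monotone and submodular (pointwise polymatroid), and equal to the goal
value `Q > 0` on every full realization (coverability). -/
structure Problem (E O : Type*) [Fintype E] [DecidableEq E] [Fintype O] [DecidableEq O] where
  c : E → ℝ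
  c_pos : ∀ e, 0 < c e
  p : (E → O) → ℝ
  p_nonneg : ∀ φ, 0 ≤ p φ
  p_sum : ∑ φ : E → O, p φ = 1
  indep : ∀ φ : E → O, p φ = ∏ e : E, ∑ φ' : E → O, if φ' e = φ e then p φ' else 0
  f : Sub E O → ℝ
  f_nonneg : ∀ ψ, 0 ≤ f ψ
  f_empty : f (fun _ => none) = 0
  f_mono : ∀ ψ ψ' : Sub E O, subext ψ ψ' → f ψ ≤ f ψ'
  f_submod : ∀ (ψ ψ' : Sub E O) (e : E) (o : O), subext ψ ψ' → ψ' e = none →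
      f (updateSub ψ' e o) - f ψ' ≤ f (updateSub ψ e o) - f ψ
  Q : ℝ
  Q_pos : 0 < Q
  f_cover : ∀ φ : E → O, f (toSub φ) = Q

variable (M : Problem E O)

/-- Expectation of a random variable `X` with respect to the random realization `Φ`. -/
def Ex (X : (E → O) → ℝ) : ℝ := ∑ φ : E → O, M.p φ * X φ

/-- Probability of an event `A` of the random realization `Φ`. -/
def Pr (A : (E → O) → Prop) : ℝ := ∑ φ : E → O, if A φ then M.p φ else 0

/-- Conditional expectation `E[X | A]`. -/
def cEx (X : (E → O) → ℝ) (A : (E → O) → Prop) : ℝ :=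
  (∑ φ : E → O, if A φ then M.p φ * X φ else 0) / Pr M A

/-- The random marginal increase in utility `F_ψ(e)` from observing the state of `e`. -/
def Fm (ψ : Sub E O) (e : E) (φ : E → O) : ℝ := M.f (updateSub ψ e (φ e)) - M.f ψ

/-- The unit price `υ(e|ψ) = c(e) / E[F_ψ(e)]`. -/
def price (ψ : Sub E O) (e : E) : ℝ := M.c e / Ex M (Fm M ψ e)

/-- An adaptive covering policy: at every subrealization `ψ` with `f ψ < Q` it selects an
item outside `dom ψ`. -/
def IsPolicy (π : Sub E O → E) : Prop := ∀ ψ : Sub E O, M.f ψ < M.Q → ψ (π ψ) = none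

/-- The `α`-approximate adaptive greedy policy: at every `ψ` with `f ψ < Q` the unit price of
the selected item `σ ψ` is at most `α` times the minimum unit price, i.e.
`υ(σ ψ | ψ) ≤ α · υ(e | ψ)` for every `e ∉ dom ψ`, written multiplicatively so that infinite
unit prices (zero expected marginal utility) are handled correctly. -/
def IsGreedy (α : ℝ) (σ : Sub E O → E) : Prop :=
  IsPolicy M σ ∧
    ∀ ψ : Sub E O, M.f ψ < M.Q → ∀ e : E, ψ e = none →
      M.c (σ ψ) * Ex M (Fm M ψ e) ≤ α * M.c e * Ex M (Fm M ψ (σ ψ))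

/-- One step of executing policy `π` on realization `φ`. -/
def stepPol (π : Sub E O → E) (φ : E → O) (ψ : Sub E O) : Sub E O :=
  if M.f ψ < M.Q then updateSub ψ (π ψ) (φ (π ψ)) else ψ

/-- The subrealization reached after `n` steps of executing `π` on `φ`. -/
def execAux (π : Sub E O → E) (φ : E → O) : ℕ → Sub E O
  | 0 => fun _ => none
  | n + 1 => stepPol M π φ (execAux π φ n)

/-- The cover `Ψ(π)` constructed by executing `π` on realization `φ`. -/
def cover (π : Sub E O → E) (φ : E → O) : Sub E O := execAux M π φ (Fintype.card E)

/-- `ψ` is visited when executing `π` on realization `φ`. -/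
def visits (π : Sub E O → E) (φ : E → O) (ψ : Sub E O) : Prop := ∃ n, execAux M π φ n = ψ

/-- The set `S(π)` of items selected when executing `π` on `φ`. -/
def Ssel (π : Sub E O → E) (φ : E → O) : Finset E :=
  Finset.univ.filter fun e => cover M π φ e ≠ none

/-- The cost `C(π)` incurred when executing `π` on `φ`. -/
def C (π : Sub E O → E) (φ : E → O) : ℝ := ∑ e ∈ Ssel M π φ, M.c e

/-- An adaptive covering policy of minimum expected cost. -/
def IsOptimal (π : Sub E O → E) : Prop :=
  IsPolicy M π ∧ ∀ π' : Sub E O → E, IsPolicy M π' → Ex M (C M π) ≤ Ex M (C M π')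

/-- `N(π)`: the non-leaf nodes of the decision tree of `π` — subrealizations with
`f ψ < Q` that are visited with positive probability. -/
def Nnodes (π : Sub E O → E) : Finset (Sub E O) :=
  Finset.univ.filter fun ψ => M.f ψ < M.Q ∧ 0 < Pr M fun φ => visits M π φ ψ

/-- The event `ψ ↝ i`, for a marker located at utility value `b = f(ρ_i)`:
`ψ` is the last subrealization visited by `σ` (on the given realization) whose
utility is at most `b`. -/
def leadsTo (σ : Sub E O → E) (b : ℝ) (ψ : Sub E O) (φ : E → O) : Prop :=
  visits M σ φ ψ ∧ M.f ψ ≤ b ∧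
    ∀ ψ' : Sub E O, visits M σ φ ψ' → M.f ψ' ≤ b → subext ψ' ψ

/-- The revenue `λ_i = υ_ψ · ε_i` collected by `σ` from the marker located at utility
value `b = f(ρ_i)` with interval length `εi`, where `ψ` is the unique subrealization
with `ψ ↝ i`. -/
def lam (σ : Sub E O → E) (b εi : ℝ) (φ : E → O) : ℝ :=
  ∑ ψ : Sub E O, if leadsTo M σ b ψ φ then price M ψ (σ ψ) * εi else 0

/-- The revenue `μ(e)` collected by the optimal policy `πs` from item `e`
(relative to the greedy policy `σ`, both executed on the same realization). -/
def mu (σ πs : Sub E O → E) (e : E) (φ : E → O) : ℝ :=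
  if e ∈ Ssel M πs φ then
    if e ∈ Ssel M σ φ then
      ∑ ψ : Sub E O,
        if visits M σ φ ψ ∧ M.f ψ < M.Q ∧ σ ψ = e then price M ψ e * Fm M ψ e φ else 0
    else M.c e
  else 0

/-- The total revenue `μ*` collected by the optimal policy. -/
def muStar (σ πs : Sub E O → E) (φ : E → O) : ℝ := ∑ e : E, mu M σ πs e φ

/-- Replay of the internal state of policy `πs` in the second stage of the hybrid policy:
starting from the empty subrealization, repeatedly query `πs`; an item whose state is
already recorded in `ψ'` is not re-selected, its recorded state being used instead. -/
def replayAux (πs : Sub E O → E) (ψ' : Sub E O) : ℕ → Sub E O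
  | 0 => fun _ => none
  | n + 1 =>
    if M.f (replayAux πs ψ' n) < M.Q then
      match ψ' (πs (replayAux πs ψ' n)) with
      | some o => updateSub (replayAux πs ψ' n) (πs (replayAux πs ψ' n)) o
      | none => replayAux πs ψ' n
    else replayAux πs ψ' n

/-- The hybrid policy `π^ψ0`: follow `σ` until `ψ0` is visited, then switch to executing
`πs` from the root of its tree, never re-selecting an item of `dom ψ0` and using the
state recorded in `ψ0` instead. -/
def hybrid (σ πs : Sub E O → E) (ψ0 : Sub E O) : Sub E O → E := fun ψ' =>
  if subext ψ0 ψ' then πs (replayAux M πs ψ' (Fintype.card E)) else σ ψ'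

/-- `δ⁺_ψ0(e)`: the marginal utility obtained by the hybrid policy `π^ψ0` when it selects
`e` during its second stage, and `0` if `e` is not selected in the second stage. -/
def deltaPlus (σ πs : Sub E O → E) (ψ0 : Sub E O) (e : E) (φ : E → O) : ℝ :=
  ∑ ψ' : Sub E O,
    if subext ψ0 ψ' ∧ visits M (hybrid M σ πs ψ0) φ ψ' ∧
        ssubext ψ' (cover M (hybrid M σ πs ψ0) φ) ∧ hybrid M σ πs ψ0 ψ' = e
    then Fm M ψ' e φ else 0



/-- Domain of a subrealization. -/
def dmn (ψ : Sub E O) : Finset E := Finset.univ.filter fun x => ψ x ≠ none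

theorem mem_dmn (ψ : Sub E O) (x : E) : x ∈ dmn ψ ↔ ψ x ≠ none := by simp [dmn]

theorem card_dmn_update (ψ : Sub E O) (x : E) (o : O) (h : ψ x = none) :
    (dmn ψ).card + 1 ≤ (dmn (updateSub ψ x o)).card := by
  have hx : x ∉ dmn ψ := by simp [mem_dmn, h]
  rw [← Finset.card_insert_of_notMem hx]
  apply Finset.card_le_card
  intro y hy
  rw [mem_dmn, updateSub]
  rcases Finset.mem_insert.1 hy with h1 | h1
  · simp [h1]
  · rw [mem_dmn] at h1
    split_ifs <;> simp [h1]

theorem full_f (ψ : Sub E O) (h : Fintype.card E ≤ (dmn ψ).card) : M.f ψ = M.Q := by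
  have h1 : dmn ψ = Finset.univ := by
    apply Finset.eq_univ_of_card
    exact le_antisymm (Finset.card_le_univ _) h
  have h2 : ∀ x, ∃ o, ψ x = some o := by
    intro x
    have : x ∈ dmn ψ := by rw [h1]; exact Finset.mem_univ x
    rw [mem_dmn] at this
    exact Option.ne_none_iff_exists'.1 this
  choose φ hφ using h2
  have : ψ = toSub φ := funext hφ
  rw [this, M.f_cover]

theorem exec_consistent (π : Sub E O → E) (φ : E → O) (n : ℕ) :
    subext (execAux M π φ n) (toSub φ) := by
  induction n with
  | zero => intro x o h; simp [execAux] at h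
  | succ n ih =>
    intro x o h
    simp only [execAux, stepPol] at h
    split_ifs at h
    · simp only [updateSub] at h
      split_ifs at h with h2
      · rw [← h, h2]; rfl
      · exact ih x o h
    · exact ih x o h

theorem exec_step (π : Sub E O → E) (φ : E → O) (n : ℕ) :
    subext (execAux M π φ n) (execAux M π φ (n + 1)) := by
  intro x o h
  simp only [execAux, stepPol]
  split_ifs
  · simp only [updateSub]
    split_ifs with h2
    · have := exec_consistent M π φ n x o h
      rw [← this, h2]; rfl
    · exact h
  · exact h

theorem exec_mono (π : Sub E O → E) (φ : E → O) {n m : ℕ} (h : n ≤ m) :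
    subext (execAux M π φ n) (execAux M π φ m) := by
  induction m, h using Nat.le_induction with
  | base => intro x o h; exact h
  | succ m _ ih => intro x o h; exact exec_step M π φ m x o (ih x o h)

theorem exec_stable (π : Sub E O → E) (φ : E → O) {n m : ℕ} (h : n ≤ m)
    (hf : ¬ M.f (execAux M π φ n) < M.Q) : execAux M π φ m = execAux M π φ n := by
  induction m, h using Nat.le_induction with
  | base => rfl
  | succ m _ ih =>
    rw [execAux, ih, stepPol, if_neg hf]

theorem exec_card (π : Sub E O → E) (hπ : IsPolicy M π) (φ : E → O) (n : ℕ) :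
    ¬ M.f (execAux M π φ n) < M.Q ∨ n ≤ (dmn (execAux M π φ n)).card := by
  induction n with
  | zero => right; exact Nat.zero_le _
  | succ n ih =>
    by_cases hf : M.f (execAux M π φ n) < M.Q
    · right
      rcases ih with h | h
      · exact absurd hf h
      · rw [execAux, stepPol, if_pos hf]
        have := card_dmn_update (execAux M π φ n) (π (execAux M π φ n))
          (φ (π (execAux M π φ n))) (hπ _ hf)
        omega
    · left
      rw [exec_stable M π φ (Nat.le_succ n) hf]; exact hf

theorem cover_done (π : Sub E O → E) (hπ : IsPolicy M π) (φ : E → O) :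
    ¬ M.f (cover M π φ) < M.Q := by
  rcases exec_card M π hπ φ (Fintype.card E) with h | h
  · exact h
  · have := full_f M _ h
    rw [cover, this]; exact lt_irrefl _

theorem exec_sub_cover (π : Sub E O → E) (hπ : IsPolicy M π) (φ : E → O) (n : ℕ) :
    subext (execAux M π φ n) (cover M π φ) := by
  rcases le_total n (Fintype.card E) with h | h
  · exact exec_mono M π φ h
  · rw [exec_stable M π φ h (cover_done M π hπ φ)]; intro x o h; exact h

theorem exec_lt_of_ne (π : Sub E O → E) (hπ : IsPolicy M π) (φ : E → O) (n : ℕ)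
    (hne : execAux M π φ n ≠ cover M π φ) : M.f (execAux M π φ n) < M.Q := by
  by_contra hf
  rcases le_total n (Fintype.card E) with h | h
  · exact hne (exec_stable M π φ h hf).symm
  · exact hne (exec_stable M π φ h (cover_done M π hπ φ))

/-- If `e` is not selected on `φ`, changing the state of `e` does not change the execution. -/
theorem exec_congr (π : Sub E O → E) (hπ : IsPolicy M π) (φ φ' : E → O) (e : E)
    (hφ : ∀ x, x ≠ e → φ x = φ' x) (he : e ∉ Ssel M π φ) (n : ℕ) :
    execAux M π φ n = execAux M π φ' n := by
  have hnone : ∀ n, execAux M π φ n e = none := by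
    intro n
    by_contra h
    obtain ⟨o, ho⟩ := Option.ne_none_iff_exists'.1 h
    have := exec_sub_cover M π hπ φ n e o ho
    apply he
    simp [Ssel, this]
  induction n with
  | zero => rfl
  | succ n ih =>
    have h1 := hnone (n + 1)
    simp only [execAux, stepPol] at h1 ⊢
    rw [← ih]
    split_ifs at h1 ⊢ with hf
    · have : π (execAux M π φ n) ≠ e := by
        intro h
        simp [updateSub, h] at h1
      rw [hφ _ this]
    · rfl

theorem Ssel_congr (π : Sub E O → E) (hπ : IsPolicy M π) (φ φ' : E → O) (e : E)
    (hφ : ∀ x, x ≠ e → φ x = φ' x) : e ∈ Ssel M π φ ↔ e ∈ Ssel M π φ' := by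
  have key : ∀ φ φ' : E → O, (∀ x, x ≠ e → φ x = φ' x) → e ∉ Ssel M π φ → e ∉ Ssel M π φ' := by
    intro φ φ' hφ h
    have := exec_congr M π hπ φ φ' e hφ h (Fintype.card E)
    have hc : cover M π φ = cover M π φ' := this
    simp only [Ssel, Finset.mem_filter, Finset.mem_univ, true_and] at h ⊢
    rw [← hc]
    exact h
  exact not_iff_not.1 ⟨key φ φ' hφ, key φ' φ fun x hx => (hφ x hx).symm⟩

theorem event_congr (σ πs : Sub E O → E) (hσ : IsPolicy M σ) (hπs : IsPolicy M πs)
    (b : ℝ) (ψ : Sub E O) (φ φ' : E → O) (e : E) (hφ : ∀ x, x ≠ e → φ x = φ' x)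
    (h : (e ∈ Ssel M πs φ ∧ e ∉ Ssel M σ φ) ∧ leadsTo M σ b ψ φ) :
    (e ∈ Ssel M πs φ' ∧ e ∉ Ssel M σ φ') ∧ leadsTo M σ b ψ φ' := by
  obtain ⟨⟨h1, h2⟩, h3⟩ := h
  refine ⟨⟨(Ssel_congr M πs hπs φ φ' e hφ).1 h1,
    fun h => h2 ((Ssel_congr M σ hσ φ φ' e hφ).2 h)⟩, ?_⟩
  have hv : visits M σ φ = visits M σ φ' := by
    funext χ
    simp only [visits, exec_congr M σ hσ φ φ' e hφ h2]
  simpa only [leadsTo, hv] using h3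

theorem replay_sub (πs : Sub E O → E) (ψ' : Sub E O) (n : ℕ) :
    subext (replayAux M πs ψ' n) ψ' := by
  induction n with
  | zero => intro x o h; simp [replayAux] at h
  | succ n ih =>
    intro x o h
    rw [replayAux] at h
    split_ifs at h with hf
    · rcases ho : ψ' (πs (replayAux M πs ψ' n)) with _ | o'
      · rw [ho] at h; exact ih x o h
      · rw [ho] at h
        simp only [updateSub] at h
        split_ifs at h with h2
        · rw [h2, ho, h]
        · exact ih x o h
    · exact ih x o h

theorem replay_card (πs : Sub E O → E) (hπs : IsPolicy M πs) (ψ' : Sub E O)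
    (hψ : M.f ψ' < M.Q) (n : ℕ) :
    ψ' (πs (replayAux M πs ψ' n)) = none ∨ n ≤ (dmn (replayAux M πs ψ' n)).card := by
  induction n with
  | zero => right; exact Nat.zero_le _
  | succ n ih =>
    have hf : M.f (replayAux M πs ψ' n) < M.Q :=
      lt_of_le_of_lt (M.f_mono _ _ (replay_sub M πs ψ' n)) hψ
    rcases ho : ψ' (πs (replayAux M πs ψ' n)) with _ | o
    · left
      have : replayAux M πs ψ' (n + 1) = replayAux M πs ψ' n := by
        rw [replayAux, if_pos hf, ho]
      rw [this, ho]
    · right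
      have h : n ≤ (dmn (replayAux M πs ψ' n)).card := by
        rcases ih with h | h
        · rw [h] at ho; cases ho
        · exact h
      have : replayAux M πs ψ' (n + 1) =
          updateSub (replayAux M πs ψ' n) (πs (replayAux M πs ψ' n)) o := by
        rw [replayAux, if_pos hf, ho]
      rw [this]
      have := card_dmn_update (replayAux M πs ψ' n) (πs (replayAux M πs ψ' n)) o (hπs _ hf)
      omega

theorem hybrid_policy (σ πs : Sub E O → E) (hσ : IsPolicy M σ) (hπs : IsPolicy M πs)
    (ψ0 : Sub E O) : IsPolicy M (hybrid M σ πs ψ0) := by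
  intro ψ' hψ
  rw [hybrid]
  split_ifs with h
  · rcases replay_card M πs hπs ψ' hψ (Fintype.card E) with h | h
    · exact h
    · have h1 := full_f M _ h
      have h2 := M.f_mono _ _ (replay_sub M πs ψ' (Fintype.card E))
      linarith
  · exact hσ ψ' hψ

theorem Fm_nonneg (ψ : Sub E O) (e : E) (he : ψ e = none) (φ : E → O) : 0 ≤ Fm M ψ e φ := by
  rw [Fm, sub_nonneg]
  apply M.f_mono
  intro x o h
  rw [updateSub]
  split_ifs with h2
  · rw [h2, he] at h; cases h
  · exact h

theorem deltaPlus_le (σ πs : Sub E O → E) (hσ : IsPolicy M σ) (hπs : IsPolicy M πs)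
    (ψ : Sub E O) (e : E) (he : ψ e = none) (φ : E → O) :
    deltaPlus M σ πs ψ e φ ≤ Fm M ψ e φ := by
  have hP := hybrid_policy M σ πs hσ hπs ψ
  set π := hybrid M σ πs ψ with hπdef
  rw [deltaPlus, ← Finset.sum_filter]
  set T := Finset.univ.filter fun ψ' : Sub E O => subext ψ ψ' ∧ visits M π φ ψ' ∧
        ssubext ψ' (cover M π φ) ∧ π ψ' = e with hT
  have aux : ∀ n m, n < m → M.f (execAux M π φ n) < M.Q → M.f (execAux M π φ m) < M.Q →
      π (execAux M π φ n) = e → π (execAux M π φ m) = e → False := by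
    intro n m hnm h1 h2 h3 h4
    have h5 : execAux M π φ (n + 1) e = some (φ e) := by
      rw [execAux, stepPol, if_pos h1, h3]; simp [updateSub]
    have h6 := exec_mono M π φ hnm e _ h5
    have h7 := hP _ h2
    rw [h4, h6] at h7
    cases h7
  have huniq : T.card ≤ 1 := by
    rw [Finset.card_le_one]
    intro a ha b hb
    simp only [hT, Finset.mem_filter, Finset.mem_univ, true_and] at ha hb
    obtain ⟨_, ⟨n, rfl⟩, ha3, ha4⟩ := ha
    obtain ⟨_, ⟨m, rfl⟩, hb3, hb4⟩ := hb
    have h1 := exec_lt_of_ne M π hP φ n ha3.2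
    have h2 := exec_lt_of_ne M π hP φ m hb3.2
    rcases lt_trichotomy n m with h | h | h
    · exact (aux n m h h1 h2 ha4 hb4).elim
    · rw [h]
    · exact (aux m n h h2 h1 hb4 ha4).elim
  have hterm : ∀ a ∈ T, Fm M a e φ ≤ Fm M ψ e φ := by
    intro a ha
    simp only [hT, Finset.mem_filter, Finset.mem_univ, true_and] at ha
    obtain ⟨ha1, ⟨n, rfl⟩, ha3, ha4⟩ := ha
    have h1 := exec_lt_of_ne M π hP φ n ha3.2
    have h2 := hP _ h1
    rw [ha4] at h2
    exact M.f_submod _ _ e (φ e) ha1 h2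
  have h0 := Fm_nonneg M ψ e he φ
  rcases Finset.card_le_one_iff_subset_singleton.1 huniq with ⟨x, hx⟩
  rcases Finset.subset_singleton_iff.1 hx with h | h
  · rw [h, Finset.sum_empty]; exact h0
  · rw [h, Finset.sum_singleton]; exact hterm x (by rw [h]; simp)

/-- Marginal probability. -/
def qm (e : E) (o : O) : ℝ := ∑ φ' : E → O, if φ' e = o then M.p φ' else 0

theorem qm_sum (e : E) : ∑ o, qm M e o = 1 := by
  simp only [qm]
  rw [Finset.sum_comm, ← M.p_sum]
  apply Finset.sum_congr rfl
  intro φ _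
  simp

theorem p_update (φ : E → O) (e : E) (o : O) :
    M.p (Function.update φ e o) * qm M e (φ e) = M.p φ * qm M e o := by
  have hp : ∀ φ, M.p φ = qm M e (φ e) * ∏ x ∈ Finset.univ.erase e, qm M x (φ x) := by
    intro φ
    rw [Finset.mul_prod_erase _ (fun x => qm M x (φ x)) (Finset.mem_univ e), M.indep φ]
    rfl
  rw [hp φ, hp (Function.update φ e o)]
  have : ∏ x ∈ Finset.univ.erase e, qm M x (Function.update φ e o x) =
      ∏ x ∈ Finset.univ.erase e, qm M x (φ x) := by
    apply Finset.prod_congr rfl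
    intro x hx
    rw [Function.update_of_ne (Finset.ne_of_mem_erase hx)]
  rw [this, Function.update_self]
  ring

theorem sum_indep (B : (E → O) → Prop) (e : E)
    (hB : ∀ φ o, B φ → B (Function.update φ e o)) (g : O → ℝ) :
    (∑ φ, if B φ then M.p φ * g (φ e) else 0) = Pr M B * ∑ o, qm M e o * g o := by
  have hB' : ∀ φ o, B (Function.update φ e o) ↔ B φ := by
    intro φ o
    refine ⟨fun h => ?_, hB φ o⟩
    have := hB _ (φ e) h
    simpa using this
  have h1 : (∑ φ, if B φ then M.p φ * g (φ e) else 0) =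
      ∑ x : (E → O) × O, (if B x.1 then M.p x.1 * qm M e x.2 * g (x.1 e) else 0) := by
    rw [Fintype.sum_prod_type]
    apply Finset.sum_congr rfl
    intro φ _
    dsimp only
    split_ifs
    · rw [← Finset.sum_mul, ← Finset.mul_sum, qm_sum, mul_one]
    · simp
  have h2 : Pr M B * ∑ o, qm M e o * g o =
      ∑ x : (E → O) × O, (if B x.1 then M.p x.1 * (qm M e x.2 * g x.2) else 0) := by
    rw [Fintype.sum_prod_type, Pr, Finset.sum_mul]
    apply Finset.sum_congr rfl
    intro φ _
    dsimp only
    split_ifs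
    · rw [Finset.mul_sum]
    · simp
  rw [h1, h2]
  have hinv : Function.Involutive
      (fun x : (E → O) × O => ((Function.update x.1 e x.2, x.1 e) : (E → O) × O)) := by
    intro x
    simp
  refine Fintype.sum_equiv hinv.toPerm _ _ ?_
  intro x
  simp only [Function.Involutive.coe_toPerm, hB']
  split_ifs
  · rw [← mul_assoc, p_update]
  · rfl

theorem sum_indep_Fm (B : (E → O) → Prop) (e : E)
    (hB : ∀ φ o, B φ → B (Function.update φ e o)) (ψ : Sub E O) :
    (∑ φ, if B φ then M.p φ * Fm M ψ e φ else 0) = Pr M B * Ex M (Fm M ψ e) := by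
  have h1 := sum_indep M B e hB (fun o => M.f (updateSub ψ e o) - M.f ψ)
  have h2 := sum_indep M (fun _ => True) e (fun _ _ _ => trivial)
    (fun o => M.f (updateSub ψ e o) - M.f ψ)
  simp only [if_true, Pr, M.p_sum, one_mul] at h2
  simp only [Fm, Ex] at *
  rw [h1, h2]

/-- For `ψ ∈ N(σ)`, a marker index `i` with `Pr[ψ ↝ i] > 0`, and
`e ∉ dom ψ`, conditioned additionally on the event `A(e)` that `e` is selected by `π*`
but not by `σ`: `α·E[μ(e) | A(e) ∧ ψ ↝ i] ≥ υ_ψ·E[δ⁺_ψ(e) | A(e) ∧ ψ ↝ i]`. -/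
theorem mu_delta_bound_on_A
    (M : Problem E O) (α : ℝ) (hα : 1 ≤ α)
    (σ : Sub E O → E) (hσ : IsGreedy M α σ)
    (πs : Sub E O → E) (hπs : IsOptimal M πs)
    (t : ℕ) (ρ : ℕ → Sub E O)
    (hcard : t = (Nnodes M σ).card)
    (hρmem : ∀ i, 1 ≤ i → i ≤ t → ρ i ∈ Nnodes M σ)
    (hρinj : ∀ i j, 1 ≤ i → i ≤ t → 1 ≤ j → j ≤ t → ρ i = ρ j → i = j)
    (hρmono : ∀ i j, 1 ≤ i → i ≤ j → j ≤ t → M.f (ρ i) ≤ M.f (ρ j))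
    (i : ℕ) (hi1 : 1 ≤ i) (hit : i ≤ t)
    (ψ : Sub E O) (hmem : ψ ∈ Nnodes M σ)
    (hpos : 0 < Pr M (leadsTo M σ (M.f (ρ i)) ψ))
    (e : E) (he : ψ e = none) :
    price M ψ (σ ψ) *
        cEx M (deltaPlus M σ πs ψ e)
          (fun φ => (e ∈ Ssel M πs φ ∧ e ∉ Ssel M σ φ) ∧ leadsTo M σ (M.f (ρ i)) ψ φ)
      ≤ α * cEx M (mu M σ πs e)
          (fun φ => (e ∈ Ssel M πs φ ∧ e ∉ Ssel M σ φ) ∧ leadsTo M σ (M.f (ρ i)) ψ φ) := by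
  obtain ⟨B, hBdef⟩ : ∃ B : (E → O) → Prop, B = fun φ =>
    (e ∈ Ssel M πs φ ∧ e ∉ Ssel M σ φ) ∧ leadsTo M σ (M.f (ρ i)) ψ φ := ⟨_, rfl⟩
  rw [← hBdef]
  have hf : M.f ψ < M.Q := by
    have := hmem
    simp only [Nnodes, Finset.mem_filter] at this
    exact this.2.1
  have hB : ∀ φ o, B φ → B (Function.update φ e o) := by
    intro φ o h
    rw [hBdef] at h ⊢
    refine event_congr M σ πs hσ.1 hπs.1 _ ψ φ _ e ?_ h
    intro x hx
    rw [Function.update_of_ne hx]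
  have hPr : 0 ≤ Pr M B := by
    apply Finset.sum_nonneg
    intro φ _
    split_ifs
    · exact M.p_nonneg φ
    · exact le_rfl
  have hEx : ∀ x, ψ x = none → 0 ≤ Ex M (Fm M ψ x) := fun x hx =>
    Finset.sum_nonneg fun φ _ => mul_nonneg (M.p_nonneg φ) (Fm_nonneg M ψ x hx φ)
  have hExσ := hEx (σ ψ) (hσ.1 ψ hf)
  have hprice0 : 0 ≤ price M ψ (σ ψ) := div_nonneg (M.c_pos _).le hExσ
  have hmu : (∑ φ, if B φ then M.p φ * mu M σ πs e φ else 0) = Pr M B * M.c e := by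
    rw [Pr, Finset.sum_mul]
    apply Finset.sum_congr rfl
    intro φ _
    split_ifs with h
    · rw [hBdef] at h
      rw [mu, if_pos h.1.1, if_neg h.1.2]
    · simp
  have hdelta : (∑ φ, if B φ then M.p φ * deltaPlus M σ πs ψ e φ else 0) ≤
      Pr M B * Ex M (Fm M ψ e) := by
    rw [← sum_indep_Fm M B e hB ψ]
    apply Finset.sum_le_sum
    intro φ _
    split_ifs
    · exact mul_le_mul_of_nonneg_left (deltaPlus_le M σ πs hσ.1 hπs.1 ψ e he φ) (M.p_nonneg φ)
    · exact le_rfl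
  have hgreedy : price M ψ (σ ψ) * Ex M (Fm M ψ e) ≤ α * M.c e := by
    rcases hExσ.eq_or_lt with h | h
    · rw [price, ← h, div_zero, zero_mul]
      exact mul_nonneg (by linarith) (M.c_pos e).le
    · rw [price, div_mul_eq_mul_div, div_le_iff₀ h]
      exact hσ.2 ψ hf e he
  rw [cEx, cEx, hmu, ← mul_div_assoc, ← mul_div_assoc]
  apply div_le_div_of_nonneg_right _ hPr
  calc _ ≤ price M ψ (σ ψ) * (Pr M B * Ex M (Fm M ψ e)) :=
        mul_le_mul_of_nonneg_left hdelta hprice0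
    _ = Pr M B * (price M ψ (σ ψ) * Ex M (Fm M ψ e)) := by ring
    _ ≤ Pr M B * (α * M.c e) := mul_le_mul_of_nonneg_left hgreedy hPr
    _ = _ := by ring

end
end SSC
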